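/- Let π be a node map between two graphs such that (none, none) ∉ π, and let (f, σ) be a swap of π of size K ≥ 2. Then the swapped node map π' := SWAP(π, f, σ) satisfies S(π') = S(π) + |{i ∈ S : a (σ i) = none ∧ b i = none}|, i.e., the number of substitutions increases by exactly the number of indices whose backward assignment is the dummy assignment (none, none). -/

import Mathlib

/-- A node map between two graphs with node sets `VG` and `VH`: a finite set of
assignments (pairs of optional nodes, `none` modelling the dummy symbol ε) such that
every node of `G` occurs as the first component of exactly one assignment, and every
node of `H` occurs as the second component of exactly one assignment. -/
def IsNodeMap {VG VH : Type*} (π : Finset (Option VG × Option VH)) : Prop :=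
  (∀ u : VG, ∃! w : Option VH, (some u, w) ∈ π) ∧
    (∀ v : VH, ∃! w : Option VG, (w, some v) ∈ π)

/-- A swap of size `K` of the node map `π`: an injective map `f` from a `K`-element
index type `S` into `π`, together with a permutation `σ` of `S` that is a single
`K`-cycle (its support is all of `S`). -/
def IsSwap {VG VH S : Type*} [Fintype S] [DecidableEq S]
    (π : Finset (Option VG × Option VH)) (f : S → Option VG × Option VH)
    (σ : Equiv.Perm S) (K : ℕ) : Prop :=
  Function.Injective f ∧ (∀ i : S, f i ∈ π) ∧ Fintype.card S = K ∧ 2 ≤ K ∧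
    σ.IsCycle ∧ σ.support = Finset.univ

/-- The node map obtained from `π` by carrying out the swap `(f, σ)`: remove the
forward assignments `F = f '' S` and add the backward assignments
`β i = ((f (σ i)).1, (f i).2)`, except for the dummy assignment `(none, none)`. -/
def SWAP {VG VH S : Type*} [DecidableEq VG] [DecidableEq VH] [Fintype S] [DecidableEq S]
    (π : Finset (Option VG × Option VH)) (f : S → Option VG × Option VH)
    (σ : Equiv.Perm S) : Finset (Option VG × Option VH) :=
  (π \ Finset.univ.image f) ∪
    (Finset.univ.filter fun i : S =>
        ((f (σ i)).1, (f i).2) ≠ ((none : Option VG), (none : Option VH))).image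
      (fun i : S => ((f (σ i)).1, (f i).2))

/-- The number of node substitutions contained in a node map. -/
def numSub {VG VH : Type*} [DecidableEq VG] [DecidableEq VH]
    (π : Finset (Option VG × Option VH)) : ℕ :=
  (π.filter fun p => p.1 ≠ none ∧ p.2 ≠ none).card

open Finset in
/-- Inclusion-exclusion for two predicates on a finite type, without subtraction. -/
theorem card_filter_and_add_card {S : Type*} [Fintype S] (P Q : S → Prop)
    [DecidablePred P] [DecidablePred Q] :
    #{i | P i ∧ Q i} + Fintype.card S = #{i | P i} + #{i | Q i} + #{i | ¬P i ∧ ¬Q i} := by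
  rw [← Finset.card_univ, Finset.card_eq_sum_ones Finset.univ]
  simp only [Finset.card_filter, ← Finset.sum_add_distrib]
  refine Finset.sum_congr rfl fun i _ => ?_
  by_cases hP : P i <;> by_cases hQ : Q i <;> simp [hP, hQ]

open Finset in
/-- Precomposing one of two predicates, which are never false simultaneously, with a permutation
increases the number of indices satisfying both by the number of indices satisfying neither. -/
theorem card_filter_perm_and {S : Type*} [Fintype S] (P Q : S → Prop)
    [DecidablePred P] [DecidablePred Q] (σ : Equiv.Perm S) (h : ∀ i, P i ∨ Q i) :
    #{i | P (σ i) ∧ Q i} = #{i | P i ∧ Q i} + #{i | ¬P (σ i) ∧ ¬Q i} := by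
  have h_perm : #{i | P (σ i)} = #{i | P i} :=
    Finset.card_equiv σ (by simp)
  have h_neither : #{i | ¬P i ∧ ¬Q i} = 0 := by
    simpa [Finset.filter_eq_empty_iff, or_iff_not_imp_left] using h
  have h₁ := card_filter_and_add_card P Q
  have h₂ := card_filter_and_add_card (fun i => P (σ i)) Q
  omega

/-- Two assignments of a node map with the same non-dummy second component agree. -/
theorem IsNodeMap.eq_of_snd_eq {VG VH : Type*} {π : Finset (Option VG × Option VH)}
    (hπ : IsNodeMap π) {p q : Option VG × Option VH} (hp : p ∈ π) (hq : q ∈ π)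
    (h : p.2 = q.2) (h_ne : p.2 ≠ none) : p = q := by
  obtain ⟨a, b⟩ := p
  obtain ⟨c, d⟩ := q
  obtain rfl : b = d := h
  obtain ⟨v, rfl⟩ := Option.ne_none_iff_exists'.mp h_ne
  rw [(hπ.2 v).unique hp hq]

/-- The number of substitutions is additive over unions with no substitution in common. -/
theorem numSub_union {VG VH : Type*} [DecidableEq VG] [DecidableEq VH]
    {π ρ : Finset (Option VG × Option VH)}
    (h : ∀ p ∈ π, p ∈ ρ → ¬(p.1 ≠ none ∧ p.2 ≠ none)) :
    numSub (π ∪ ρ) = numSub π + numSub ρ := by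
  rw [numSub, Finset.filter_union, Finset.card_union_of_disjoint, numSub, numSub]
  rw [Finset.disjoint_left]
  intro p hp hp'
  rw [Finset.mem_filter] at hp hp'
  exact h p hp.1 hp'.1 hp.2

open Finset in
/-- The substitutions in the image of a family of assignments can be counted by their indices
if the family is injective on assignments with non-dummy second component. -/
theorem numSub_image {VG VH S : Type*} [DecidableEq VG] [DecidableEq VH]
    (s : Finset S) (g : S → Option VG × Option VH)
    (hg : ∀ i j, g i = g j → (g i).2 ≠ none → i = j) :
    numSub (s.image g) = #{i ∈ s | (g i).1 ≠ none ∧ (g i).2 ≠ none} := by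
  rw [numSub, Finset.filter_image, Finset.card_image_of_injOn]
  intro i hi j _ hij
  exact hg i j hij (Finset.mem_filter.mp hi).2.2

/-- If `π` is a node map not containing the dummy assignment
`(none, none)` and `(f, σ)` is a swap of `π` of size `K ≥ 2`, then the number of node
substitutions of the swapped node map `SWAP π f σ` exceeds that of `π` by exactly
the number of indices whose backward assignment is the dummy assignment
`(none, none)`. -/
theorem numSub_swap_eq {VG VH S : Type*} [Fintype VG] [Fintype VH]
    [DecidableEq VG] [DecidableEq VH] [Fintype S] [DecidableEq S] (K : ℕ)
    (π : Finset (Option VG × Option VH)) (hπ : IsNodeMap π)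
    (hdummy : ((none : Option VG), (none : Option VH)) ∉ π)
    (f : S → Option VG × Option VH) (σ : Equiv.Perm S)
    (hswap : IsSwap π f σ K) :
    numSub (SWAP π f σ)
      = numSub π
        + (Finset.univ.filter fun i : S => (f (σ i)).1 = none ∧ (f i).2 = none).card := by
  obtain ⟨hf, hfπ, -⟩ := hswap
  have h_old : numSub π = numSub (π \ Finset.univ.image f) + numSub (Finset.univ.image f) := by
    rw [← numSub_union fun p hp hp' => absurd hp' (Finset.mem_sdiff.mp hp).2,
      Finset.sdiff_union_of_subset]
    simpa [Finset.image_subset_iff] using hfπ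
  have h_forward := numSub_image Finset.univ f fun i j h _ => hf h
  have h_new : numSub (SWAP π f σ) = numSub (π \ Finset.univ.image f) +
      (Finset.univ.filter fun i : S => (f (σ i)).1 ≠ none ∧ (f i).2 ≠ none).card := by
    rw [SWAP, numSub_union, numSub_image, Finset.filter_filter]
    · congr 2
      ext i
      simp +contextual
    · intro i j h h_ne
      exact hf (hπ.eq_of_snd_eq (hfπ i) (hfπ j) (Prod.ext_iff.mp h).2 h_ne)
    · intro p hp hp' h_sub
      obtain ⟨i, -, rfl⟩ := Finset.mem_image.mp hp'
      obtain ⟨h_mem, h_not_mem⟩ := Finset.mem_sdiff.mp hp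
      refine h_not_mem (Finset.mem_image.mpr ⟨i, Finset.mem_univ i, ?_⟩)
      exact hπ.eq_of_snd_eq (hfπ i) h_mem rfl h_sub.2
  have h_count := card_filter_perm_and (fun i => (f i).1 ≠ none) (fun i => (f i).2 ≠ none) σ
    fun i => by
      by_contra! h
      have h_eq : f i = (none, none) := Prod.ext h.1 h.2
      exact hdummy (h_eq ▸ hfπ i)
  simp only [not_not] at h_count
  omega
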